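/- For every ε ∈ {±1} and every s ∈ ℂ with −1 < Re(s) < −1/2, the series Σ_{d=3}^{∞} (−εi)^d (d−1) Q(d,s) converges absolutely and equals Γ(3/2+s)/Γ(3/2−s) + iε·Γ(1+s)/Γ(1−s). -/

import Mathlib

open MeasureTheory

/-- `Q(d,s) = Γ((d−1)/2+s) / Γ((d+1)/2−s)`. -/
noncomputable def Qfun (d : ℕ) (s : ℂ) : ℂ :=
  Complex.Gamma (((d : ℂ) - 1) / 2 + s) / Complex.Gamma (((d : ℂ) + 1) / 2 - s)

open Filter Topology

lemma Complex.norm_betaIntegral_le {u v : ℂ} :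
    ‖Complex.betaIntegral u v‖ ≤ ‖Complex.betaIntegral (u.re : ℂ) (v.re : ℂ)‖ := by
  have hnorm : ∀ x ∈ Set.Ioo (0 : ℝ) 1,
      ‖(x : ℂ) ^ (u - 1) * (1 - (x : ℂ)) ^ (v - 1)‖ =
        x ^ (u.re - 1) * (1 - x) ^ (v.re - 1) := by
    intro x hx
    rw [norm_mul, Complex.norm_cpow_eq_rpow_re_of_pos hx.1]
    have h1 : (1 - (x : ℂ)) = ((1 - x : ℝ) : ℂ) := by push_cast; rfl
    rw [h1, Complex.norm_cpow_eq_rpow_re_of_pos (by linarith [hx.2])]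
    simp
  have hreal : Complex.betaIntegral (u.re : ℂ) (v.re : ℂ) =
      ((∫ x in (0 : ℝ)..1, x ^ (u.re - 1) * (1 - x) ^ (v.re - 1) : ℝ) : ℂ) := by
    rw [Complex.betaIntegral, ← intervalIntegral.integral_ofReal]
    refine intervalIntegral.integral_congr fun x hx => ?_
    rw [Set.uIcc_of_le zero_le_one] at hx
    have hx1 : 0 ≤ 1 - x := by linarith [hx.2]
    rw [Complex.ofReal_mul, Complex.ofReal_cpow hx.1, Complex.ofReal_cpow hx1]
    push_cast
    rfl
  rw [hreal, Complex.norm_real]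
  calc ‖Complex.betaIntegral u v‖
      ≤ ∫ x in (0 : ℝ)..1, ‖(x : ℂ) ^ (u - 1) * (1 - (x : ℂ)) ^ (v - 1)‖ :=
        intervalIntegral.norm_integral_le_integral_norm zero_le_one
    _ = ∫ x in (0 : ℝ)..1, x ^ (u.re - 1) * (1 - x) ^ (v.re - 1) := by
        simp only [intervalIntegral.integral_of_le zero_le_one, integral_Ioc_eq_integral_Ioo]
        exact setIntegral_congr_fun measurableSet_Ioo hnorm
    _ ≤ _ := Real.le_norm_self _

/-- A quotient of Gamma values with fixed difference of arguments is dominated, up to a constant,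
by the same quotient at the real parts. -/
lemma Complex.exists_norm_Gamma_div_Gamma_add_le {v : ℂ} (hv : 0 < v.re) :
    ∃ C : ℝ, ∀ u : ℂ, 0 < u.re →
      ‖Complex.Gamma u / Complex.Gamma (u + v)‖ ≤
        C * (Real.Gamma u.re / Real.Gamma (u.re + v.re)) := by
  refine ⟨Real.Gamma v.re / ‖Complex.Gamma v‖, fun u hu => ?_⟩
  have hGv : Complex.Gamma v ≠ 0 := Complex.Gamma_ne_zero_of_re_pos hv
  have hGuv : Complex.Gamma (u + v) ≠ 0 :=
    Complex.Gamma_ne_zero_of_re_pos (by simpa using add_pos hu hv)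
  have hR : 0 < Real.Gamma (u.re + v.re) := Real.Gamma_pos_of_pos (add_pos hu hv)
  have hRu : 0 < Real.Gamma u.re := Real.Gamma_pos_of_pos hu
  have hRv : 0 < Real.Gamma v.re := Real.Gamma_pos_of_pos hv
  have h1 := Complex.Gamma_mul_Gamma_eq_betaIntegral hu hv
  have h2 := Complex.Gamma_mul_Gamma_eq_betaIntegral
    (s := (u.re : ℂ)) (t := (v.re : ℂ)) (by simpa using hu) (by simpa using hv)
  rw [← Complex.ofReal_add] at h2
  simp only [Complex.Gamma_ofReal] at h2
  have h3 := congrArg norm h2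
  simp only [norm_mul, Complex.norm_real, Real.norm_of_nonneg hR.le, Real.norm_of_nonneg hRu.le,
    Real.norm_of_nonneg hRv.le] at h3
  have h4 := Complex.norm_betaIntegral_le (u := u) (v := v)
  have h5 : Complex.Gamma u / Complex.Gamma (u + v) =
      Complex.betaIntegral u v / Complex.Gamma v := by
    rw [div_eq_div_iff hGuv hGv, h1, mul_comm]
  have h6 : ‖Complex.betaIntegral (u.re : ℂ) (v.re : ℂ)‖ =
      Real.Gamma u.re * Real.Gamma v.re / Real.Gamma (u.re + v.re) := by
    rw [h3]; field_simp
  rw [h5, norm_div, div_mul_eq_mul_div]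
  gcongr
  rw [h6] at h4
  exact h4.trans_eq (by ring)

lemma Real.summable_Gamma_div_Gamma_add {a b : ℝ} (ha : 0 < a) (hb : 1 < b) :
    Summable fun k : ℕ => Real.Gamma (a + k) / Real.Gamma (a + k + b) := by
  have hk (k : ℕ) : 0 < a + k := by positivity
  have hstep (k : ℕ) : (b - 1) * (Real.Gamma (a + k) / Real.Gamma (a + k + b)) =
      Real.Gamma (a + k) / Real.Gamma (a + k + b - 1) -
        Real.Gamma (a + (k + 1 : ℕ)) / Real.Gamma (a + (k + 1 : ℕ) + b - 1) := by
    have hne : a + k + b - 1 ≠ 0 := by linarith [hk k]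
    have e1 : Real.Gamma (a + k + b) = (a + k + b - 1) * Real.Gamma (a + k + b - 1) := by
      rw [← Real.Gamma_add_one hne]; congr 1; ring
    have e2 : Real.Gamma (a + (k + 1 : ℕ)) = (a + k) * Real.Gamma (a + k) := by
      rw [← Real.Gamma_add_one (hk k).ne']; congr 1; push_cast; ring
    have e3 : Real.Gamma (a + (k + 1 : ℕ) + b - 1) = Real.Gamma (a + k + b) := by
      congr 1; push_cast; ring
    have hG : Real.Gamma (a + k + b - 1) ≠ 0 :=
      (Real.Gamma_pos_of_pos (by linarith [hk k])).ne'
    rw [e3, e2, e1]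
    field_simp
    ring
  have hb' : 0 < b - 1 := by linarith
  rw [← summable_mul_left_iff hb'.ne']
  refine summable_of_sum_range_le (c := Real.Gamma a / Real.Gamma (a + b - 1))
    (fun k => ?_) (fun n => ?_)
  · have := Real.Gamma_pos_of_pos (hk k)
    have := Real.Gamma_pos_of_pos (show 0 < a + k + b by linarith [hk k])
    positivity
  · simp only [hstep]
    rw [Finset.sum_range_sub' (fun k : ℕ => Real.Gamma (a + k) / Real.Gamma (a + k + b - 1))]
    have := Real.Gamma_pos_of_pos (hk n)
    have := Real.Gamma_pos_of_pos (show 0 < a + n + b - 1 by linarith [hk n])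
    have : 0 ≤ Real.Gamma (a + n) / Real.Gamma (a + n + b - 1) := by positivity
    simpa using this

lemma Complex.summable_norm_Gamma_div_Gamma {s : ℂ} {x : ℝ} (hx : 0 < x + s.re)
    (hs : s.re < -(1 / 2)) :
    Summable fun k : ℕ => ‖Complex.Gamma (x + k + s) / Complex.Gamma (x + k - s)‖ := by
  obtain ⟨C, hC⟩ := Complex.exists_norm_Gamma_div_Gamma_add_le (v := -2 * s)
    (by simp; linarith)
  refine Summable.of_nonneg_of_le (fun _ => norm_nonneg _) (fun k => ?_)
    ((Real.summable_Gamma_div_Gamma_add (a := x + s.re) (b := (-2 * s).re) hx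
      (by simp; linarith)).mul_left C)
  have hre : ((x : ℂ) + k + s).re = x + s.re + k := by simp; ring
  have h := hC (x + k + s) (by rw [hre]; positivity)
  rw [hre] at h
  convert h using 4
  ring

lemma Complex.two_mul_Gamma_div_Gamma {y s : ℂ} (h1 : y + s ≠ 0) (h2 : 0 < (y - s).re) :
    2 * y * (Complex.Gamma (y + s) / Complex.Gamma (y + 1 - s)) =
      Complex.Gamma (y + s) / Complex.Gamma (y - s) +
        Complex.Gamma (y + 1 + s) / Complex.Gamma (y + 1 - s) := by
  have hne : y - s ≠ 0 := by
    intro h0; simp [h0] at h2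
  have hG : Complex.Gamma (y - s) ≠ 0 := Complex.Gamma_ne_zero_of_re_pos h2
  rw [show y + 1 + s = y + s + 1 by ring, show y + 1 - s = y - s + 1 by ring,
    Complex.Gamma_add_one _ h1, Complex.Gamma_add_one _ hne]
  field_simp
  ring

lemma Complex.hasSum_alternating_Gamma_div_Gamma {s : ℂ} {x : ℝ} (hx : 0 < x + s.re)
    (hs : s.re < -(1 / 2)) :
    (Summable fun k : ℕ =>
      ‖2 * ((x : ℂ) + k) * (Complex.Gamma (x + k + s) / Complex.Gamma (x + k + 1 - s))‖) ∧
    HasSum (fun k : ℕ => (-1 : ℂ) ^ k *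
      (2 * ((x : ℂ) + k) * (Complex.Gamma (x + k + s) / Complex.Gamma (x + k + 1 - s))))
      (Complex.Gamma (x + s) / Complex.Gamma (x - s)) := by
  set A : ℕ → ℂ := fun k => Complex.Gamma (x + k + s) / Complex.Gamma (x + k - s) with hA
  have hAs : Summable fun k => ‖A k‖ := Complex.summable_norm_Gamma_div_Gamma hx hs
  have hstep (k : ℕ) :
      2 * ((x : ℂ) + k) * (Complex.Gamma (x + k + s) / Complex.Gamma (x + k + 1 - s)) =
        A k + A (k + 1) := by
    have hk : (0 : ℝ) ≤ k := k.cast_nonneg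
    rw [Complex.two_mul_Gamma_div_Gamma]
    · simp only [hA]; push_cast; simp only [add_assoc]
    · intro h0
      have := congrArg Complex.re h0
      simp at this
      linarith
    · simp; linarith
  simp only [hstep]
  have hsum : Summable fun k => ‖A k + A (k + 1)‖ :=
    Summable.of_nonneg_of_le (fun _ => norm_nonneg _) (fun _ => norm_add_le _ _)
      (hAs.add ((summable_nat_add_iff 1).2 hAs))
  have hsum' : Summable fun k => ‖(-1 : ℂ) ^ k * (A k + A (k + 1))‖ := by
    simpa using hsum
  refine ⟨hsum, (hsum'.of_norm.hasSum_iff_tendsto_nat).2 ?_⟩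
  have hpart (n : ℕ) : ∑ k ∈ Finset.range n, (-1 : ℂ) ^ k * (A k + A (k + 1)) =
      A 0 - (-1) ^ n * A n := by
    have := Finset.sum_range_sub' (fun k : ℕ => (-1 : ℂ) ^ k * A k) n
    simp only [pow_zero, one_mul] at this
    rw [← this]
    exact Finset.sum_congr rfl fun k _ => by ring
  have hlim : Tendsto (fun n : ℕ => (-1 : ℂ) ^ n * A n) atTop (𝓝 0) := by
    rw [tendsto_zero_iff_norm_tendsto_zero]
    simpa using hAs.tendsto_atTop_zero
  simp only [hpart]
  simpa [hA] using hlim.const_sub (A 0)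

/-- Evaluation of the series `Σ_{d=3}^∞ (−εi)^d (d−1) Q(d,s)`. -/
theorem stmt12 (ε : ℂ) (hε : ε = 1 ∨ ε = -1) (s : ℂ)
    (h : -1 < s.re) (h' : s.re < -(1 / 2)) :
    Summable (fun n : ℕ => ‖(-ε * Complex.I) ^ (n + 3) * ((n : ℂ) + 2) * Qfun (n + 3) s‖) ∧
    ∑' n : ℕ, (-ε * Complex.I) ^ (n + 3) * ((n : ℂ) + 2) * Qfun (n + 3) s =
      Complex.Gamma (3 / 2 + s) / Complex.Gamma (3 / 2 - s) +
        Complex.I * ε * Complex.Gamma (1 + s) / Complex.Gamma (1 - s) := by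
  have hsq : (-ε * Complex.I) ^ 2 = -1 := by
    rcases hε with rfl | rfl <;> simp
  set q := -ε * Complex.I with hq
  have hq3 : q ^ 3 = Complex.I * ε := by
    rw [pow_succ, hsq, hq]; ring
  have hq4 : q ^ 4 = 1 := by
    rw [show 4 = 2 * 2 from rfl, pow_mul, hsq]; norm_num
  obtain ⟨hn1, hs1⟩ := Complex.hasSum_alternating_Gamma_div_Gamma (s := s) (x := 1)
    (by linarith) h'
  obtain ⟨hn2, hs2⟩ := Complex.hasSum_alternating_Gamma_div_Gamma (s := s) (x := 3 / 2)
    (by linarith) h'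
  have heven (k : ℕ) : q ^ (2 * k + 3) * (((2 * k : ℕ) : ℂ) + 2) * Qfun (2 * k + 3) s =
      q ^ 3 * ((-1) ^ k * (2 * (((1 : ℝ) : ℂ) + k) *
        (Complex.Gamma ((1 : ℝ) + k + s) / Complex.Gamma ((1 : ℝ) + k + 1 - s)))) := by
    rw [pow_add, pow_mul, hsq, Qfun]
    push_cast
    rw [show ((2 * (k : ℂ) + 3 - 1) / 2 + s) = 1 + k + s by ring,
      show ((2 * (k : ℂ) + 3 + 1) / 2 - s) = 1 + k + 1 - s by ring]
    ring
  have hodd (k : ℕ) : q ^ (2 * k + 1 + 3) * (((2 * k + 1 : ℕ) : ℂ) + 2) *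
      Qfun (2 * k + 1 + 3) s =
      (-1) ^ k * (2 * (((3 / 2 : ℝ) : ℂ) + k) *
        (Complex.Gamma ((3 / 2 : ℝ) + k + s) / Complex.Gamma ((3 / 2 : ℝ) + k + 1 - s))) := by
    rw [add_assoc (2 * k), pow_add, pow_mul, hsq, show 1 + 3 = 4 from rfl, hq4, Qfun]
    push_cast
    rw [show ((2 * (k : ℂ) + 4 - 1) / 2 + s) = 3 / 2 + k + s by ring,
      show ((2 * (k : ℂ) + 4 + 1) / 2 - s) = 3 / 2 + k + 1 - s by ring]
    ring
  constructor
  · refine Summable.even_add_odd ?_ ?_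
    · simp only [heven, norm_mul _ ((-1 : ℂ) ^ _ * _), norm_mul ((-1 : ℂ) ^ _), norm_pow, norm_neg,
        norm_one, one_pow, one_mul]
      exact hn1.mul_left _
    · simp only [hodd, norm_mul ((-1 : ℂ) ^ _), norm_pow, norm_neg, norm_one, one_pow, one_mul]
      exact hn2
  · refine (HasSum.even_add_odd (f := fun n : ℕ => q ^ (n + 3) * ((n : ℂ) + 2) * Qfun (n + 3) s)
      (by simpa only [heven] using hs1.mul_left (q ^ 3))
      (by simpa only [hodd] using hs2)).tsum_eq.trans ?_
    rw [hq3]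
    push_cast
    ring
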